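/- arXiv:1804.03322 — 2 statements merged into one kernel-verified Lean document; each statement's English description precedes it below -/
import Mathlib

section
/- Let M be a finite commutative monoid acting faithfully and irreducibly on a nonempty set Y, let e be the minimal idempotent of M, let X := eY, let η : M → End(X) be the monoid homomorphism induced by the action of M on X, let M̄ := η(M), let G be the Grothendieck group of M̄, and let τ(G) be the torsion subgroup of G. Then eM is a finite abelian group with identity e, G is finite (so G = τ(G)), and the map φ : eM → τ(G) sending em to the class of (η(em), id) is a group isomorphism. -/
/-!
Grothendieck group of a commutative monoid, monoid actions, H-invertible elements,
and the induced action of a subgroup of the Grothendieck group.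
-/

namespace AbelianNetworks

variable (M : Type*) [CommMonoid M]

/-- The defining relation of the Grothendieck group of a commutative monoid:
`(m₁, m₁') ∼ (m₂, m₂')` iff there is `m` with `m * m₁ * m₂' = m * m₁' * m₂`. -/
instance grothSetoid : Setoid (M × M) where
  r p q := ∃ m : M, m * p.1 * q.2 = m * p.2 * q.1
  iseqv := by
    refine ⟨fun p => ⟨1, ?_⟩, ?_, ?_⟩
    · simp only [mul_assoc, mul_comm, mul_left_comm]
    · rintro p q ⟨m, hm⟩
      refine ⟨m, ?_⟩
      calc m * q.1 * p.2 = m * p.2 * q.1 := by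
            simp only [mul_assoc, mul_comm, mul_left_comm]
        _ = m * p.1 * q.2 := hm.symm
        _ = m * q.2 * p.1 := by
            simp only [mul_assoc, mul_comm, mul_left_comm]
    · rintro p q r ⟨m, hm⟩ ⟨n, hn⟩
      refine ⟨m * n * q.2, ?_⟩
      calc m * n * q.2 * p.1 * r.2
          = m * p.1 * q.2 * (n * r.2) := by
            simp only [mul_assoc, mul_comm, mul_left_comm]
        _ = m * p.2 * q.1 * (n * r.2) := by rw [hm]
        _ = n * q.1 * r.2 * (m * p.2) := by
            simp only [mul_assoc, mul_comm, mul_left_comm]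
        _ = n * q.2 * r.1 * (m * p.2) := by rw [hn]
        _ = m * n * q.2 * p.2 * r.1 := by
            simp only [mul_assoc, mul_comm, mul_left_comm]

/-- The Grothendieck group of the commutative monoid `M`, as the quotient of `M × M`
by the relation above. -/
def Groth := Quotient (grothSetoid M)

/-- The class of the pair `(m, m')` in the Grothendieck group; `(m, m')` is called a
*representative* of this class. -/
def Groth.mk (m m' : M) : Groth M := Quotient.mk (grothSetoid M) (m, m')

instance : One (Groth M) := ⟨Groth.mk M 1 1⟩

instance : Mul (Groth M) :=
  ⟨Quotient.map₂ (fun p q => (p.1 * q.1, p.2 * q.2)) (by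
    rintro ⟨a, a'⟩ ⟨b, b'⟩ ⟨m, hm⟩ ⟨c, c'⟩ ⟨d, d'⟩ ⟨n, hn⟩
    refine ⟨m * n, ?_⟩
    calc m * n * (a * c) * (b' * d')
        = m * a * b' * (n * c * d') := by
          simp only [mul_assoc, mul_comm, mul_left_comm]
      _ = m * a' * b * (n * c' * d) := by rw [hm, hn]
      _ = m * n * (a' * c') * (b * d) := by
          simp only [mul_assoc, mul_comm, mul_left_comm])⟩

instance : Inv (Groth M) :=
  ⟨Quotient.map (fun p => (p.2, p.1)) (by
    rintro ⟨a, a'⟩ ⟨b, b'⟩ ⟨m, hm⟩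
    exact ⟨m, hm.symm⟩)⟩

/-- The Grothendieck group of a commutative monoid is an abelian group. -/
instance : CommGroup (Groth M) where
  mul_assoc := by
    rintro ⟨⟨a, a'⟩⟩ ⟨⟨b, b'⟩⟩ ⟨⟨c, c'⟩⟩
    exact Quotient.sound ⟨1, by simp only [one_mul, mul_one, mul_assoc, mul_comm, mul_left_comm]⟩
  one_mul := by
    rintro ⟨⟨a, a'⟩⟩
    exact Quotient.sound ⟨1, by simp only [one_mul, mul_one, mul_assoc, mul_comm, mul_left_comm]⟩
  mul_one := by
    rintro ⟨⟨a, a'⟩⟩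
    exact Quotient.sound ⟨1, by simp only [one_mul, mul_one, mul_assoc, mul_comm, mul_left_comm]⟩
  inv_mul_cancel := by
    rintro ⟨⟨a, a'⟩⟩
    exact Quotient.sound ⟨1, by simp only [one_mul, mul_one, mul_assoc, mul_comm, mul_left_comm]⟩
  mul_comm := by
    rintro ⟨⟨a, a'⟩⟩ ⟨⟨b, b'⟩⟩
    exact Quotient.sound ⟨1, by simp only [one_mul, mul_one, mul_assoc, mul_comm, mul_left_comm]⟩

variable {M}
variable {X : Type*} [MulAction M X]

/-- `ActsTo g x y` says that `y` is a value of `g · x`: for every representative `(m, m')`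
of `g` one has `m • x = m' • y`. -/
def ActsTo (g : Groth M) (x y : X) : Prop :=
  ∀ m m' : M, g = Groth.mk M m m' → m • x = m' • y

/-- An element `x ∈ X` is `H`-invertible if for every `g ∈ H` there is `x_g ∈ X` with
`m • x = m' • x_g` for every representative `(m, m')` of `g`. -/
def IsInvertibleUnder (H : Subgroup (Groth M)) (x : X) : Prop :=
  ∀ g ∈ H, ∃ y : X, ActsTo g x y

section FiniteMonoid

variable (M Y : Type*) [CommMonoid M] [Fintype M] [MulAction M Y]

/-- The minimal idempotent of a finite commutative monoid: the product of all of its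
idempotent elements. -/
noncomputable def minIdem : M :=
  open scoped Classical in
  ∏ f ∈ Finset.univ.filter (fun f : M => f * f = f), f

/-- The subset `X := e • Y` of `Y`, where `e` is the minimal idempotent of `M`. -/
def eSet : Set Y := Set.range fun y : Y => minIdem M • y

/-- The monoid homomorphism `η : M → End(X)` induced by the action of `M` on `X = e • Y`. -/
noncomputable def eta : M →* Function.End (eSet M Y) where
  toFun m := fun x => ⟨m • (x : Y), by
    obtain ⟨y, hy⟩ := x.2
    refine ⟨m • y, ?_⟩
    show minIdem M • m • y = m • (x : Y)
    rw [smul_smul, mul_comm, ← smul_smul]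
    exact congrArg (fun z => m • z) hy⟩
  map_one' := by
    funext x
    exact Subtype.ext (one_smul M (x : Y))
  map_mul' m n := by
    funext x
    exact Subtype.ext (mul_smul m n (x : Y))

/-- The image `M̄ = η(M) ⊆ End(X)` of the monoid `M` is a commutative monoid. -/
noncomputable instance : CommMonoid ↥(MonoidHom.mrange (eta M Y)) :=
  { (inferInstance : Monoid ↥(MonoidHom.mrange (eta M Y))) with
    mul_comm := by
      intro a b
      obtain ⟨m, hm⟩ := MonoidHom.mem_mrange.mp a.2
      obtain ⟨n, hn⟩ := MonoidHom.mem_mrange.mp b.2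
      apply Subtype.ext
      show (a : Function.End (eSet M Y)) * b = (b : Function.End (eSet M Y)) * a
      rw [← hm, ← hn, ← map_mul, ← map_mul, mul_comm] }

/-- The element `η(e * m)` of `M̄ = η(M)`. -/
noncomputable def fbar (m : M) : ↥(MonoidHom.mrange (eta M Y)) :=
  ⟨eta M Y (minIdem M * m), MonoidHom.mem_mrange.mpr ⟨minIdem M * m, rfl⟩⟩

/-- The map `φ : e • M → τ(G)` sending `e * m` to the class of `(η(e * m), 1)` in the
Grothendieck group `G` of `M̄ = η(M)`, viewed as a function on `M`. -/
noncomputable def phiMap (m : M) : Groth ↥(MonoidHom.mrange (eta M Y)) :=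
  Groth.mk _ (fbar M Y m) 1

theorem exists_pow_succ_mul_self_eq {N : Type*} [Monoid N] [Finite N] (a : N) :
    ∃ n : ℕ, a ^ (n + 1) * a ^ (n + 1) = a ^ (n + 1) := by
  obtain ⟨i, j, hij, h⟩ := Finite.exists_ne_map_eq_of_infinite fun n : ℕ => a ^ n
  wlog hlt : i < j generalizing i j
  · exact this j i hij.symm h.symm (by omega)
  obtain ⟨p, rfl⟩ := Nat.exists_eq_add_of_lt hlt
  have step : ∀ k r : ℕ, a ^ (i + r + k * (p + 1)) = a ^ (i + r) := by
    intro k r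
    induction k with
    | zero => simp
    | succ k ih =>
      calc a ^ (i + r + (k + 1) * (p + 1)) = a ^ (i + p + 1) * a ^ (r + k * (p + 1)) := by
            rw [← pow_add]; congr 1; ring
        _ = a ^ i * a ^ (r + k * (p + 1)) := by rw [← h]
        _ = a ^ (i + r) := by rw [← pow_add, ← add_assoc, ih]
  refine ⟨i + (i * p + p), ?_⟩
  have key := step (i + 1) (i * p + p + 1)
  rw [← pow_add]
  convert key using 2 <;> ring

section MinIdem

variable {M : Type*} [CommMonoid M] [Fintype M]

theorem minIdem_mul_self : minIdem M * minIdem M = minIdem M := by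
  classical
  rw [minIdem, ← Finset.prod_mul_distrib]
  exact Finset.prod_congr rfl fun f hf => (Finset.mem_filter.mp hf).2

theorem mul_minIdem_of_mul_self {f : M} (hf : f * f = f) : f * minIdem M = minIdem M := by
  classical
  rw [minIdem, ← Finset.mul_prod_erase (Finset.univ.filter fun f : M => f * f = f) (fun f => f)
    (Finset.mem_filter.mpr ⟨Finset.mem_univ f, hf⟩), ← mul_assoc, hf]

theorem exists_mul_mul_minIdem (a : M) : ∃ b : M, b * a * minIdem M = minIdem M := by
  obtain ⟨n, hn⟩ := exists_pow_succ_mul_self_eq a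
  exact ⟨a ^ n, by rw [← pow_succ]; exact mul_minIdem_of_mul_self hn⟩

end MinIdem

theorem eta_mul_minIdem (m : M) : eta M Y (m * minIdem M) = eta M Y m := by
  funext ⟨x, y, hy⟩
  apply Subtype.ext
  change (m * minIdem M) • x = m • x
  rw [← hy]
  simp only [smul_smul, mul_assoc, minIdem_mul_self]

theorem mul_minIdem_eq_of_eta_eq (hfaith : ∀ m m' : M, (∀ y : Y, m • y = m' • y) → m = m')
    {m m' : M} (h : eta M Y m = eta M Y m') : m * minIdem M = m' * minIdem M := by
  refine hfaith _ _ fun y => ?_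
  rw [mul_smul, mul_smul]
  exact congrArg Subtype.val (congrFun h ⟨minIdem M • y, y, rfl⟩)

/-- Let `M` be a finite commutative monoid acting faithfully and irreducibly on a nonempty
set `Y`, `e` its minimal idempotent, `X := e • Y`, `η : M → End(X)` the induced homomorphism
with image `M̄`, and `G` the Grothendieck group of `M̄`.  Then `e • M` is a finite abelian
group with identity `e` (it is closed under multiplication, contains `e`, `e` is an identity
on it, and inverses exist in it), `G` is finite (so `G` equals its torsion subgroup `τ(G)`),
and `φ : e • M → τ(G)`, `e * m ↦ class of (η(e * m), 1)`, is a group isomorphism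
(it is multiplicative, injective on `e • M`, and surjective). -/
theorem eM_group_iso_torsion_of_grothendieck
    (hY : Nonempty Y)
    (hfaith : ∀ m m' : M, (∀ y : Y, m • y = m' • y) → m = m')
    (hirr : ∀ y y' : Y, ∃ m m' : M, m • y = m' • y') :
    ((∀ s ∈ Set.range fun m : M => minIdem M * m, ∀ t ∈ Set.range fun m : M => minIdem M * m,
        s * t ∈ Set.range fun m : M => minIdem M * m) ∧
      (minIdem M ∈ Set.range fun m : M => minIdem M * m) ∧
      (∀ s ∈ Set.range fun m : M => minIdem M * m, minIdem M * s = s) ∧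
      (∀ s ∈ Set.range fun m : M => minIdem M * m,
        ∃ t ∈ Set.range fun m : M => minIdem M * m, s * t = minIdem M)) ∧
    Finite (Groth ↥(MonoidHom.mrange (eta M Y))) ∧
    CommGroup.torsion (Groth ↥(MonoidHom.mrange (eta M Y))) = ⊤ ∧
    (∀ m m' : M, phiMap M Y (m * m') = phiMap M Y m * phiMap M Y m') ∧
    (∀ m m' : M, phiMap M Y m = phiMap M Y m' → minIdem M * m = minIdem M * m') ∧
    Function.Surjective (phiMap M Y) := by
  have he := minIdem_mul_self (M := M)
  have : Finite ↥(MonoidHom.mrange (eta M Y)) := Set.finite_range (eta M Y)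
  have : Finite (Groth ↥(MonoidHom.mrange (eta M Y))) := Quotient.finite _
  refine ⟨⟨?_, ⟨1, mul_one _⟩, ?_, ?_⟩, inferInstance,
    eq_top_iff.mpr fun g _ => isOfFinOrder_of_finite g, ?_, ?_, ?_⟩
  · rintro _ ⟨a, rfl⟩ _ ⟨b, rfl⟩
    exact ⟨a * (minIdem M * b), (mul_assoc _ _ _).symm⟩
  · rintro _ ⟨a, rfl⟩
    change minIdem M * (minIdem M * a) = minIdem M * a
    rw [← mul_assoc, he]
  · rintro _ ⟨a, rfl⟩
    obtain ⟨b, hb⟩ := exists_mul_mul_minIdem a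
    refine ⟨_, ⟨b, rfl⟩, ?_⟩
    calc minIdem M * a * (minIdem M * b) = b * a * (minIdem M * minIdem M) := by ac_rfl
      _ = minIdem M := by rw [he, hb]
  · intro m m'
    have hf : fbar M Y (m * m') = fbar M Y m * fbar M Y m' := by
      apply Subtype.ext
      change eta M Y _ = eta M Y _ * eta M Y _
      rw [← map_mul, mul_mul_mul_comm, he]
    change Groth.mk _ (fbar M Y (m * m')) 1 = Groth.mk _ (fbar M Y m * fbar M Y m') (1 * 1)
    rw [hf, one_mul]
  · intro m m' h
    obtain ⟨⟨_, k, rfl⟩, hc⟩ := Quotient.exact h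
    have hk : eta M Y (k * (minIdem M * m) * 1) = eta M Y (k * 1 * (minIdem M * m')) := by
      simp only [map_mul _ (k * _), map_mul _ k, map_one]
      exact congrArg Subtype.val hc
    have hk' := mul_minIdem_eq_of_eta_eq M Y hfaith hk
    obtain ⟨b, hb⟩ := exists_mul_mul_minIdem k
    calc minIdem M * m = b * k * (minIdem M * minIdem M) * m := by rw [he, hb]
      _ = b * (k * (minIdem M * m) * 1 * minIdem M) := by rw [mul_one]; ac_rfl
      _ = b * (k * 1 * (minIdem M * m') * minIdem M) := by rw [hk']
      _ = b * k * (minIdem M * minIdem M) * m' := by rw [mul_one]; ac_rfl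
      _ = minIdem M * m' := by rw [he, hb]
  · rintro ⟨⟨_, a, rfl⟩, ⟨_, b, rfl⟩⟩
    obtain ⟨c, hc⟩ := exists_mul_mul_minIdem b
    refine ⟨a * c, Quotient.sound ⟨1, Subtype.ext ?_⟩⟩
    change 1 * eta M Y (minIdem M * (a * c)) * eta M Y b = 1 * 1 * eta M Y a
    rw [one_mul, one_mul, one_mul, ← map_mul, ← eta_mul_minIdem M Y a]
    congr 1
    calc minIdem M * (a * c) * b = a * (c * b * minIdem M) := by ac_rfl
      _ = a * minIdem M := by rw [hc]

end FiniteMonoid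

end AbelianNetworks
end

section
/- Let M be a finite commutative monoid acting faithfully and irreducibly on a nonempty set Y, let e be the minimal idempotent of M, let X := eY, let η : M → End(X) be the induced homomorphism with image M̄, let G be the Grothendieck group of M̄, and τ(G) its torsion subgroup. Then every element of X is τ(G)-invertible (i.e. X^× = X), and the isomorphism φ : eM → τ(G), em ↦ class of (η(em), id), intertwines the actions: for all m ∈ M and x ∈ X, φ(em)·x = (em)·x. -/
/-!
Grothendieck group of a commutative monoid, monoid actions, H-invertible elements,
and the induced action of a subgroup of the Grothendieck group.
-/

namespace AbelianNetworks

variable (M : Type*) [CommMonoid M]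

variable {M}
variable {X : Type*} [MulAction M X]

/-- If every element of `M` is invertible, then a single representative of `g` determines the
value `g · x`. -/
lemma actsTo_mk_of_isUnit (hM : ∀ m : M, IsUnit m) {a b : M} {x y : X} (h : a • x = b • y) :
    ActsTo (Groth.mk M a b) x y := by
  intro m m' hg
  obtain ⟨c, hc⟩ := Quotient.exact hg
  have hc : c * a * m' = c * b * m := hc
  have hab : a * m' = b * m := (hM c).mul_left_cancel (by simpa only [mul_assoc] using hc)
  obtain ⟨u, rfl⟩ := hM b
  apply MulAction.injective u
  show (u : M) • m • x = (u : M) • m' • y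
  rw [smul_smul, ← hab, mul_comm, ← smul_smul, h, smul_comm]

/-- If every element of `M` is invertible, then every element of `X` is invertible under any
subgroup of the Grothendieck group. -/
lemma isInvertibleUnder_of_isUnit (hM : ∀ m : M, IsUnit m) (H : Subgroup (Groth M)) (x : X) :
    IsInvertibleUnder H x := by
  rintro ⟨⟨a, b⟩⟩ -
  obtain ⟨u, hu⟩ := hM b
  refine ⟨u⁻¹ • a • x, actsTo_mk_of_isUnit hM ?_⟩
  rw [← hu]
  exact (smul_inv_smul u (a • x)).symm

/-- Every element of a finite monoid has an idempotent positive power. -/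
lemma exists_pow_succ_isIdempotentElem {N : Type*} [Monoid N] [Finite N] (a : N) :
    ∃ k : ℕ, IsIdempotentElem (a ^ (k + 1)) := by
  obtain ⟨i, j, hij, h⟩ : ∃ i j : ℕ, i < j ∧ a ^ i = a ^ j := by
    obtain ⟨i, j, hne, h⟩ := Finite.exists_ne_map_eq_of_infinite (fun n : ℕ => a ^ n)
    rcases hne.lt_or_gt with hlt | hlt
    exacts [⟨i, j, hlt, h⟩, ⟨j, i, hlt, h.symm⟩]
  obtain ⟨d, rfl⟩ := Nat.exists_eq_add_of_lt hij
  have periodic (t r : ℕ) : a ^ (i + r) = a ^ (i + r + (d + 1) * t) := by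
    induction t with
    | zero => simp
    | succ t ih =>
      rw [ih, show i + r + (d + 1) * t = i + (r + (d + 1) * t) by ring, pow_add, h, ← pow_add]
      congr 1
      ring
  refine ⟨i + d * (i + 1), ?_⟩
  rw [IsIdempotentElem, ← pow_add, add_assoc i, periodic (i + 1)]
  congr 1
  ring

section FiniteMonoid

variable (M Y : Type*) [CommMonoid M] [Fintype M] [MulAction M Y]

lemma minIdem_isIdempotentElem : IsIdempotentElem (minIdem M) := by
  classical
  rw [IsIdempotentElem, minIdem, ← Finset.prod_mul_distrib]
  exact Finset.prod_congr rfl fun f hf => (Finset.mem_filter.mp hf).2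

variable {M} in
lemma mul_minIdem {f : M} (hf : IsIdempotentElem f) : f * minIdem M = minIdem M := by
  classical
  obtain ⟨c, hc⟩ : f ∣ minIdem M :=
    Finset.dvd_prod_of_mem _ (Finset.mem_filter.mpr ⟨Finset.mem_univ f, hf⟩)
  rw [hc, ← mul_assoc, hf.eq]

lemma eta_minIdem : eta M Y (minIdem M) = 1 := by
  funext ⟨_, y, rfl⟩
  apply Subtype.ext
  show minIdem M • minIdem M • y = minIdem M • y
  rw [smul_smul, (minIdem_isIdempotentElem M).eq]

/-- Every element of the image of `η` is invertible. -/
lemma isUnit_mrange_eta (b : ↥(MonoidHom.mrange (eta M Y))) : IsUnit b := by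
  obtain ⟨_, m, rfl⟩ := b
  obtain ⟨k, hk⟩ := exists_pow_succ_isIdempotentElem m
  refine IsUnit.of_mul_eq_one ⟨eta M Y (m ^ k), m ^ k, rfl⟩ (Subtype.ext ?_)
  show eta M Y m * eta M Y (m ^ k) = 1
  rw [← map_mul, ← pow_succ', ← mul_one (eta M Y _), ← eta_minIdem M Y, ← map_mul, mul_minIdem hk]

/-- Let `M` be a finite commutative monoid acting faithfully and irreducibly on a nonempty
set `Y`, `e` its minimal idempotent, `X := e • Y`, `η : M → End(X)` the induced homomorphism
with image `M̄`, `G` the Grothendieck group of `M̄` and `τ(G)` its torsion subgroup.  Then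
every element of `X` is `τ(G)`-invertible (i.e. `X^× = X`), and the isomorphism
`φ : e • M → τ(G)`, `e * m ↦ class of (η(e*m), 1)`, intertwines the actions: for all `m ∈ M`
and `x ∈ X`, `φ(e*m) • x = (e*m) • x`. -/
theorem all_invertible_and_iso_intertwines
    (hY : Nonempty Y)
    (hfaith : ∀ m m' : M, (∀ y : Y, m • y = m' • y) → m = m')
    (hirr : ∀ y y' : Y, ∃ m m' : M, m • y = m' • y') :
    (∀ x : eSet M Y,
      IsInvertibleUnder (CommGroup.torsion (Groth ↥(MonoidHom.mrange (eta M Y)))) x) ∧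
    (∀ (m : M) (x : eSet M Y),
      ActsTo (phiMap M Y m) x (eta M Y (minIdem M * m) x)) := by
  have hunit := isUnit_mrange_eta M Y
  exact ⟨isInvertibleUnder_of_isUnit hunit _,
    fun m x => actsTo_mk_of_isUnit hunit (one_smul _ _).symm⟩

end FiniteMonoid

end AbelianNetworks
end
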